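/- Let $\mathfrak{g}$ be a finite-dimensional complex simple Lie algebra. Every biderivation of the affine-Virasoro Lie algebra $\mathfrak{L}(\mathfrak{g})$ is inner: there exists $\lambda \in \mathbb{C}$ such that $F(x,y) = \lambda [x,y]$ for all $x, y \in \mathfrak{L}(\mathfrak{g})$. -/

import Mathlib

/-- The affine-Virasoro Lie algebra structure: `L` is the affine-Virasoro Lie algebra
associated with the Lie algebra `g`, with `E m x` playing the role of `x ⊗ tᵐ`,
`d m` the Virasoro generators, and central elements `K₁, K₂`. -/
structure AffineVirasoro (g L : Type*) [LieRing g] [LieAlgebra ℂ g]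
    [LieRing L] [LieAlgebra ℂ L] where
  E : ℤ → g →ₗ[ℂ] L
  d : ℤ → L
  K₁ : L
  K₂ : L
  bracket_EE : ∀ (m n : ℤ) (x y : g), ⁅E m x, E n y⁆ =
    E (m + n) ⁅x, y⁆ + (if m + n = 0 then ((m : ℂ) * killingForm ℂ g x y) • K₁ else 0)
  bracket_dE : ∀ (m n : ℤ) (x : g), ⁅d m, E n x⁆ = (n : ℂ) • E (m + n) x
  bracket_dd : ∀ m n : ℤ, ⁅d m, d n⁆ =
    ((n : ℂ) - (m : ℂ)) • d (m + n) +
      (if m + n = 0 then (((m : ℂ) ^ 3 - (m : ℂ)) / 12) • K₂ else 0)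
  central_K₁ : ∀ v : L, ⁅v, K₁⁆ = 0
  central_K₂ : ∀ v : L, ⁅v, K₂⁆ = 0
  spans : Submodule.span ℂ
    (({K₁, K₂} : Set L) ∪ Set.range d ∪ ⋃ m : ℤ, Set.range (E m)) = ⊤
  indep : ∀ (f : ℤ →₀ g) (c : ℤ →₀ ℂ) (a b : ℂ),
    ((f.sum fun m x => E m x) + (c.sum fun m t => t • d m) + a • K₁ + b • K₂ = 0) →
    f = 0 ∧ c = 0 ∧ a = 0 ∧ b = 0

/-- The degree-`n` graded component `L(g)ₙ` of the affine-Virasoro Lie algebra. -/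
def AffineVirasoro.graded {g L : Type*} [LieRing g] [LieAlgebra ℂ g]
    [LieRing L] [LieAlgebra ℂ L] (V : AffineVirasoro g L) (n : ℤ) : Submodule ℂ L :=
  if n = 0 then
    Submodule.span ℂ (Set.range (V.E 0) ∪ {V.d 0, V.K₁, V.K₂})
  else
    Submodule.span ℂ (Set.range (V.E n) ∪ {V.d n})

/-- The degree-`n` component `g̃ₙ` of the ideal `g̃ = ĝ ⊕ ℂK₁`. -/
def AffineVirasoro.gtilde {g L : Type*} [LieRing g] [LieAlgebra ℂ g]
    [LieRing L] [LieAlgebra ℂ L] (V : AffineVirasoro g L) (n : ℤ) : Submodule ℂ L :=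
  if n = 0 then
    Submodule.span ℂ (Set.range (V.E 0) ∪ {V.K₁})
  else
    Submodule.span ℂ (Set.range (V.E n))

theorem AV_ind {g L : Type*} [LieRing g] [LieAlgebra ℂ g] [LieRing L] [LieAlgebra ℂ L]
    (V : AffineVirasoro g L) {M : Type*} [AddCommGroup M] [Module ℂ M] (f h : L →ₗ[ℂ] M)
    (hK1 : f V.K₁ = h V.K₁) (hK2 : f V.K₂ = h V.K₂) (hd : ∀ n, f (V.d n) = h (V.d n))
    (hE : ∀ n x, f (V.E n x) = h (V.E n x)) : f = h := by
  apply LinearMap.ext_on V.spans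
  rintro v ((hv | ⟨n, rfl⟩) | hv)
  · rcases hv with rfl | rfl
    · exact hK1
    · exact hK2
  · exact hd n
  · obtain ⟨n, x, rfl⟩ := Set.mem_iUnion.1 hv
    exact hE n x

theorem AV_coords {g L : Type*} [LieRing g] [LieAlgebra ℂ g] [LieRing L] [LieAlgebra ℂ L]
    (V : AffineVirasoro g L) : ∃ (e : ℤ → L →ₗ[ℂ] g) (c : ℤ → L →ₗ[ℂ] ℂ),
      (∀ n m x, e n (V.E m x) = if m = n then x else 0) ∧ (∀ n m, e n (V.d m) = 0) ∧
      (∀ n, e n V.K₁ = 0) ∧ (∀ n, e n V.K₂ = 0) ∧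
      (∀ n m x, c n (V.E m x) = 0) ∧ (∀ n m, c n (V.d m) = if m = n then 1 else 0) ∧
      (∀ n, c n V.K₁ = 0) ∧ (∀ n, c n V.K₂ = 0) ∧
      (∀ v, (∀ n, e n v = 0) → (∀ n, c n v = 0) → ∀ u : L, ⁅u, v⁆ = 0) := by
  classical
  let Φ : ((ℤ →₀ g) × (ℤ →₀ ℂ) × ℂ × ℂ) →ₗ[ℂ] L :=
    (Finsupp.lsum ℂ (fun m => V.E m)).coprod ((Finsupp.linearCombination ℂ V.d).coprod
      ((LinearMap.toSpanSingleton ℂ L V.K₁).coprod (LinearMap.toSpanSingleton ℂ L V.K₂)))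
  have hΦ : ∀ f c a b, Φ (f, c, a, b) = (f.sum fun m x => V.E m x) +
      (c.sum fun m t => t • V.d m) + a • V.K₁ + b • V.K₂ := by
    intro f c a b
    simp [Φ, Finsupp.linearCombination_apply, add_assoc, Finsupp.sum]
  have pE : ∀ m x, Φ (Finsupp.single m x, 0, 0, 0) = V.E m x := by
    intro m x; simp [hΦ]
  have pd : ∀ m, Φ (0, Finsupp.single m 1, 0, 0) = V.d m := by
    intro m; simp [hΦ]
  have pK1 : Φ (0, 0, 1, 0) = V.K₁ := by simp [hΦ]
  have pK2 : Φ (0, 0, 0, 1) = V.K₂ := by simp [hΦ]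
  have inj : Function.Injective Φ := by
    rw [injective_iff_map_eq_zero]
    rintro ⟨f, c, a, b⟩ h
    rw [hΦ] at h
    obtain ⟨rfl, rfl, rfl, rfl⟩ := V.indep f c a b h
    rfl
  have surj : Function.Surjective Φ := by
    rw [← LinearMap.range_eq_top, eq_top_iff, ← V.spans, Submodule.span_le]
    rintro v ((hv | ⟨n, rfl⟩) | hv)
    · rcases hv with rfl | rfl
      · exact ⟨_, pK1⟩
      · exact ⟨_, pK2⟩
    · exact ⟨_, pd n⟩
    · obtain ⟨n, x, rfl⟩ := Set.mem_iUnion.1 hv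
      exact ⟨_, pE n x⟩
  let Ψ := LinearEquiv.ofBijective Φ ⟨inj, surj⟩
  have hΨ : ∀ p, Ψ.symm (Φ p) = p := fun p => Ψ.symm_apply_apply p
  refine ⟨fun n => Finsupp.lapply n ∘ₗ LinearMap.fst ℂ _ _ ∘ₗ Ψ.symm.toLinearMap,
    fun n => Finsupp.lapply n ∘ₗ LinearMap.fst ℂ _ _ ∘ₗ LinearMap.snd ℂ _ _ ∘ₗ Ψ.symm.toLinearMap,
    ?_, ?_, ?_, ?_, ?_, ?_, ?_, ?_, ?_⟩
  · intro n m x; simp [← pE, hΨ, Finsupp.single_apply]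
  · intro n m; simp [← pd, hΨ]
  · intro n; simp [← pK1, hΨ]
  · intro n; simp [← pK2, hΨ]
  · intro n m x; simp [← pE, hΨ]
  · intro n m; simp [← pd, hΨ, Finsupp.single_apply]
  · intro n; simp [← pK1, hΨ]
  · intro n; simp [← pK2, hΨ]
  · intro v h1 h2 u
    obtain ⟨⟨f, c, a, b⟩, rfl⟩ := surj v
    have hf : f = 0 := by ext n; simpa [hΨ] using h1 n
    have hc : c = 0 := by ext n; simpa [hΨ] using h2 n
    subst hf hc
    simp [hΦ, V.central_K₁, V.central_K₂]

/-- coordinates and their bracket rules -/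
theorem AV_coords' {g L : Type*} [LieRing g] [LieAlgebra ℂ g] [LieRing L] [LieAlgebra ℂ L]
    (V : AffineVirasoro g L) : ∃ (e : ℤ → L →ₗ[ℂ] g) (c : ℤ → L →ₗ[ℂ] ℂ),
      (c 1 (V.d 1) = 1) ∧
      (∀ m n v, e (m + n) ⁅V.d m, v⁆ = (n : ℂ) • e n v) ∧
      (∀ m n v, c (m + n) ⁅V.d m, v⁆ = ((n : ℂ) - m) * c n v) ∧
      (∀ m n x v, e (m + n) ⁅V.E m x, v⁆ = ⁅x, e n v⁆ - ((m : ℂ) * c n v) • x) ∧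
      (∀ m n x v, c n ⁅V.E m x, v⁆ = 0) ∧
      (∀ v, (∀ n, e n v = 0) → (∀ n, c n v = 0) → ∀ u : L, ⁅u, v⁆ = 0) := by
  obtain ⟨e, c, eE, ed, eK1, eK2, cE, cd, cK1, cK2, hz⟩ := AV_coords V
  have aux : ∀ (p : Prop) [Decidable p] (f : L →ₗ[ℂ] g) (a : L), f (if p then a else 0) = if p then f a else 0 := by
    intros; split_ifs <;> simp
  have aux2 : ∀ (p : Prop) [Decidable p] (f : L →ₗ[ℂ] ℂ) (a : L), f (if p then a else 0) = if p then f a else 0 := by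
    intros; split_ifs <;> simp
  refine ⟨e, c, by simp [cd], ?_, ?_, ?_, ?_, hz⟩
  · intro m n v
    have := AV_ind V (e (m + n) ∘ₗ (LieAlgebra.ad ℂ L (V.d m))) ((n : ℂ) • e n) ?_ ?_ ?_ ?_
    · exact LinearMap.congr_fun this v
    · simp [V.central_K₁, eK1]
    · simp [V.central_K₂, eK2]
    · intro k; simp [V.bracket_dd, ed, aux, eK2]
    · intro k x
      simp only [LinearMap.comp_apply, LieAlgebra.ad_apply, V.bracket_dE, map_smul, eE,
        LinearMap.smul_apply, add_right_inj]
      split_ifs with h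
      · rw [h]
      · simp
  · intro m n v
    have := AV_ind V (c (m + n) ∘ₗ (LieAlgebra.ad ℂ L (V.d m))) (((n : ℂ) - m) • c n) ?_ ?_ ?_ ?_
    · exact LinearMap.congr_fun this v
    · simp [V.central_K₁, cK1]
    · simp [V.central_K₂, cK2]
    · intro k
      simp only [LinearMap.comp_apply, LieAlgebra.ad_apply, V.bracket_dd, map_add, map_smul, cd,
        LinearMap.smul_apply, add_right_inj, aux2, cK2]
      split_ifs with h
      · simp [h]
      · simp [h]
      · simp [h]
      · simp
    · intro k x; simp [V.bracket_dE, cE]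
  · intro m n x v
    have := AV_ind V (e (m + n) ∘ₗ (LieAlgebra.ad ℂ L (V.E m x)))
      ((LieAlgebra.ad ℂ g x : g →ₗ[ℂ] g) ∘ₗ e n - (m : ℂ) • ((LinearMap.toSpanSingleton ℂ g x) ∘ₗ c n)) ?_ ?_ ?_ ?_
    · simpa [mul_smul] using LinearMap.congr_fun this v
    · simp [V.central_K₁, cK1, eK1]
    · simp [V.central_K₂, cK2, eK2]
    · intro k
      simp only [LinearMap.comp_apply, LieAlgebra.ad_apply]
      rw [← lie_skew, V.bracket_dE]
      simp only [map_neg, map_smul, eE, add_comm k m, add_right_inj, LinearMap.sub_apply, LinearMap.smul_apply, LinearMap.comp_apply, cd, ed]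
      split_ifs <;> simp
    · intro k y
      simp only [LinearMap.comp_apply, LieAlgebra.ad_apply, V.bracket_EE, map_add, eE, add_right_inj, LinearMap.sub_apply, LinearMap.smul_apply, LinearMap.comp_apply, cE, aux, map_smul, eK1]
      split_ifs <;> simp
  · intro m n x v
    have := AV_ind V (c n ∘ₗ (LieAlgebra.ad ℂ L (V.E m x))) 0 ?_ ?_ ?_ ?_
    · exact LinearMap.congr_fun this v
    · simp [V.central_K₁]
    · simp [V.central_K₂]
    · intro k
      simp only [LinearMap.comp_apply, LieAlgebra.ad_apply]
      rw [← lie_skew, V.bracket_dE]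
      simp [cE]
    · intro k y
      simp [V.bracket_EE, cE, aux2, cK1]

theorem simple_perfect {g : Type*} [LieRing g] [LieAlgebra ℂ g] [LieAlgebra.IsSimple ℂ g] :
    Submodule.span ℂ {z : g | ∃ x y : g, ⁅x, y⁆ = z} = ⊤ := by
  have h := LieAlgebra.IsSimple.eq_bot_or_eq_top (R := ℂ) (L := g) ⁅(⊤ : LieIdeal ℂ g), (⊤ : LieIdeal ℂ g)⁆
  have h3 : ⁅(⊤ : LieIdeal ℂ g), (⊤ : LieIdeal ℂ g)⁆ = ⊤ := by
    rcases h with h | h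
    · exfalso
      apply LieAlgebra.IsSimple.non_abelian (R := ℂ) (L := g)
      constructor
      intro x y
      have : ⁅x, y⁆ ∈ ⁅(⊤ : LieIdeal ℂ g), (⊤ : LieIdeal ℂ g)⁆ :=
        LieSubmodule.lie_mem_lie (LieSubmodule.mem_top x) (LieSubmodule.mem_top y)
      rw [h] at this
      simpa using this
    · exact h
  have h4 := LieSubmodule.lieIdeal_oper_eq_linear_span' (R := ℂ) (L := g) (M := g) (I := ⊤) (N := ⊤)
  rw [h3] at h4
  simpa using h4.symm

theorem simple_killing_ne {g : Type*} [LieRing g] [LieAlgebra ℂ g] [LieAlgebra.IsSimple ℂ g]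
    [FiniteDimensional ℂ g] : ∃ x y : g, killingForm ℂ g x y ≠ 0 := by
  by_contra! h
  have h1 : LieIdeal.killingCompl ℂ g ⊤ = ⊥ := LieAlgebra.IsKilling.killingCompl_top_eq_bot
  apply LieAlgebra.IsSimple.non_abelian (R := ℂ) (L := g)
  have h2 : ∀ x : g, x = 0 := by
    intro x
    have : x ∈ LieIdeal.killingCompl ℂ g ⊤ := by
      rw [LieIdeal.mem_killingCompl]; intro y _; exact h _ _
    rw [h1] at this
    simpa using this
  exact ⟨fun x y => h2 _⟩

theorem simple_center {g : Type*} [LieRing g] [LieAlgebra ℂ g] [LieAlgebra.IsSimple ℂ g]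
    (z : g) (h : ∀ x : g, ⁅x, z⁆ = 0) : z = 0 := by
  have : z ∈ LieAlgebra.center ℂ g := by
    rw [LieModule.mem_maxTrivSubmodule]; exact h
  rw [LieAlgebra.center_eq_bot] at this
  simpa using this

theorem AV_perfect {g L : Type*} [LieRing g] [LieAlgebra ℂ g] [LieAlgebra.IsSimple ℂ g]
    [FiniteDimensional ℂ g] [LieRing L] [LieAlgebra ℂ L] (V : AffineVirasoro g L)
    (f : L →ₗ[ℂ] L) (h : ∀ x y : L, f ⁅x, y⁆ = 0) : f = 0 := by
  have hE : ∀ n x, f (V.E n x) = 0 := by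
    intro n
    by_cases hn : n = 0
    · subst hn
      have : f ∘ₗ V.E 0 = 0 := by
        apply LinearMap.ext_on simple_perfect
        rintro _ ⟨x, y, rfl⟩
        have := h (V.E 0 x) (V.E 0 y)
        rw [V.bracket_EE] at this
        simpa using this
      intro x; exact LinearMap.congr_fun this x
    · intro x
      have := h (V.d 0) (V.E n x)
      rw [V.bracket_dE] at this
      simpa [hn] using this
  have hd : ∀ n, f (V.d n) = 0 := by
    intro n
    by_cases hn : n = 0
    · subst hn
      have := h (V.d 1) (V.d (-1))
      rw [V.bracket_dd] at this
      norm_num at this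
      exact this
    · have := h (V.d 0) (V.d n)
      rw [V.bracket_dd] at this
      simpa [hn] using this
  apply AV_ind V
  · obtain ⟨x, y, hxy⟩ := simple_killing_ne (g := g)
    have := h (V.E 1 x) (V.E (-1) y)
    rw [V.bracket_EE] at this
    simpa [hE, hxy] using this
  · have := h (V.d 2) (V.d (-2))
    rw [V.bracket_dd] at this
    norm_num [hd] at this
    simpa using this
  · simpa using hd
  · simpa using hE

structure AVC {g L : Type*} [LieRing g] [LieAlgebra ℂ g] [LieRing L] [LieAlgebra ℂ L]
    (V : AffineVirasoro g L) (e : ℤ → L →ₗ[ℂ] g) (c : ℤ → L →ₗ[ℂ] ℂ) : Prop where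
  c1 : c 1 (V.d 1) = 1
  ed : ∀ {m n j : ℤ}, m + n = j → ∀ v, e j ⁅V.d m, v⁆ = (n : ℂ) • e n v
  cd : ∀ {m n j : ℤ}, m + n = j → ∀ v, c j ⁅V.d m, v⁆ = ((n : ℂ) - m) * c n v
  eE : ∀ {m n j : ℤ}, m + n = j → ∀ x v, e j ⁅V.E m x, v⁆ = ⁅x, e n v⁆ - ((m : ℂ) * c n v) • x
  cE : ∀ m n x v, c n ⁅V.E m x, v⁆ = 0
  hz : ∀ v, (∀ n, e n v = 0) → (∀ n, c n v = 0) → ∀ u : L, ⁅u, v⁆ = 0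

theorem AV_star {L : Type*} [LieRing L] [LieAlgebra ℂ L]
    (F : L →ₗ[ℂ] L →ₗ[ℂ] L)
    (h1 : ∀ x y z : L, F ⁅x, y⁆ z = ⁅x, F y z⁆ - ⁅y, F x z⁆)
    (h2 : ∀ x y z : L, F x ⁅y, z⁆ = ⁅y, F x z⁆ - ⁅z, F x y⁆) (x y u v : L) :
    ⁅⁅x, y⁆, F u v⁆ + ⁅⁅u, v⁆, F x y⁆ = ⁅⁅x, v⁆, F u y⁆ + ⁅⁅u, y⁆, F x v⁆ := by
  have a := h1 x u ⁅y, v⁆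
  have b := h2 ⁅x, u⁆ y v
  rw [b] at a
  simp only [h1, h2, lie_sub] at a
  simp only [lie_lie]
  rw [← sub_eq_zero] at a ⊢
  rw [← neg_eq_zero, ← a]
  abel

theorem b00 {g L : Type*} [LieRing g] [LieAlgebra ℂ g] [LieRing L] [LieAlgebra ℂ L]
    (V : AffineVirasoro g L) (n : ℤ) : ⁅V.d 0, V.d n⁆ = (n : ℂ) • V.d n := by
  simp [V.bracket_dd]

theorem b0E {g L : Type*} [LieRing g] [LieAlgebra ℂ g] [LieRing L] [LieAlgebra ℂ L]
    (V : AffineVirasoro g L) (n : ℤ) (x : g) : ⁅V.d 0, V.E n x⁆ = (n : ℂ) • V.E n x := by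
  simp [V.bracket_dE]

theorem AV_w {g L : Type*} [LieRing g] [LieAlgebra ℂ g] [LieAlgebra.IsSimple ℂ g]
    [LieRing L] [LieAlgebra ℂ L] (V : AffineVirasoro g L)
    {e : ℤ → L →ₗ[ℂ] g} {c : ℤ → L →ₗ[ℂ] ℂ} (C : AVC V e c)
    (F : L →ₗ[ℂ] L →ₗ[ℂ] L)
    (h1 : ∀ x y z : L, F ⁅x, y⁆ z = ⁅x, F y z⁆ - ⁅y, F x z⁆)
    (h2 : ∀ x y z : L, F x ⁅y, z⁆ = ⁅y, F x z⁆ - ⁅z, F x y⁆) (u : L) :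
    ⁅u, F (V.d 0) (V.d 0)⁆ = 0 := by
  obtain ⟨y₀, hy₀⟩ : ∃ y : g, y ≠ 0 := by
    by_contra! h
    exact LieAlgebra.IsSimple.non_abelian (R := ℂ) (L := g) ⟨fun x y => h _⟩
  set w := F (V.d 0) (V.d 0) with hw
  have A3 : ∀ (m k : ℤ) (y : g), (k : ℂ) • e (m + k) (F (V.d 0) (V.E m y)) =
      ⁅y, e k w⁆ - ((m : ℂ) * c k w) • y := by
    intro m k y
    have := congrArg (e (m + k)) (h2 (V.d 0) (V.d 0) (V.E m y))
    rw [b0E, map_smul, map_smul, map_sub, C.ed (zero_add _), C.eE rfl] at this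
    push_cast at this
    linear_combination (norm := module) -this
  have A1 : ∀ k : ℤ, (k : ℂ) • e (1 + k) (F (V.d 1) (V.d 0)) = (k : ℂ) • e k w := by
    intro k
    have := congrArg (e (1 + k)) (h1 (V.d 0) (V.d 1) (V.d 0))
    rw [b00, map_smul, LinearMap.smul_apply, map_smul, map_sub, C.ed (zero_add _), C.ed rfl] at this
    push_cast at this
    linear_combination (norm := module) -this
  have A2 : ∀ k : ℤ, (k : ℂ) * c (1 + k) (F (V.d 1) (V.d 0)) = ((k : ℂ) - 1) * c k w := by
    intro k
    have := congrArg (c (1 + k)) (h1 (V.d 0) (V.d 1) (V.d 0))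
    rw [b00, map_smul, LinearMap.smul_apply, map_smul, map_sub, C.cd (zero_add _), C.cd rfl] at this
    push_cast at this
    simp only [smul_eq_mul] at this
    linear_combination -this
  have I : ∀ (m k : ℤ) (y : g), (m : ℂ) • (⁅y, e (1 + k) (F (V.d 1) (V.d 0))⁆
      - ((m : ℂ) * c (1 + k) (F (V.d 1) (V.d 0))) • y)
      - ((m : ℂ) + k) • e (m + k) (F (V.d 0) (V.E m y)) =
      (m : ℂ) • (⁅y, e k w⁆ - ((1 + m : ℂ) * c k w) • y) := by
    intro m k y
    have := congrArg (e (1 + m + k)) (AV_star F h1 h2 (V.d 0) (V.E m y) (V.d 1) (V.d 0))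
    rw [lie_self, zero_lie, zero_add, b0E, ← lie_skew (V.d 1) (V.d 0), b00, V.bracket_dE, map_add,
      neg_lie, smul_lie, smul_lie, smul_lie, map_neg, map_smul, map_smul, map_smul,
      C.eE (show m + (1 + k) = 1 + m + k by ring), C.ed (show 1 + (m + k) = 1 + m + k by ring),
      C.eE rfl] at this
    push_cast at this
    linear_combination (norm := module) this
  have eps : ∀ k, e k w = 0 := by
    intro k
    apply simple_center
    intro y
    have a := A3 0 k y
    have i := I 0 k y
    by_cases hk : k = 0
    · subst hk
      simpa using a.symm
    · have hk' : (k : ℂ) ≠ 0 := by exact_mod_cast hk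
      simp [hk'] at i
      simp [i] at a
      exact a.symm
  have gam : ∀ k, c k w = 0 := by
    intro k
    by_cases hk : k = 0
    · subst hk
      have := A3 1 0 y₀
      simpa [eps, hy₀] using this.symm
    · have hk' : (k : ℂ) ≠ 0 := by exact_mod_cast hk
      have a := A3 k k y₀
      have a1 := A1 k
      have a2 := A2 k
      have i := I k k y₀
      rw [eps, smul_zero, smul_eq_zero_iff_right hk'] at a1
      rw [eps, lie_zero] at a i
      rw [a1, lie_zero] at i
      have : (4 * (k : ℂ) ^ 2 * c k w) • y₀ = 0 := by
        have h3 : ((k : ℂ) * k * (k * c (1 + k) (F (V.d 1) (V.d 0)))) • y₀ =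
          ((k : ℂ) * k * ((k - 1) * c k w)) • y₀ := by rw [a2]
        linear_combination (norm := module) (k : ℂ) • i + h3 + (2 * k : ℂ) • a
      rcases smul_eq_zero.1 this with h | h
      · simpa [hk'] using h
      · exact absurd h hy₀
  exact C.hz w eps gam u

theorem AV_P {g L : Type*} [LieRing g] [LieAlgebra ℂ g] [LieAlgebra.IsSimple ℂ g]
    [LieRing L] [LieAlgebra ℂ L] (V : AffineVirasoro g L)
    {e : ℤ → L →ₗ[ℂ] g} {c : ℤ → L →ₗ[ℂ] ℂ} (C : AVC V e c)
    (F : L →ₗ[ℂ] L →ₗ[ℂ] L)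
    (h1 : ∀ x y z : L, F ⁅x, y⁆ z = ⁅x, F y z⁆ - ⁅y, F x z⁆)
    (h2 : ∀ x y z : L, F x ⁅y, z⁆ = ⁅y, F x z⁆ - ⁅z, F x y⁆)
    (norm : c 1 (F (V.d 1) (V.d 0)) = 0) (u v : L) :
    ⁅v, F u (V.d 0)⁆ = 0 := by
  have hw := AV_w V C F h1 h2
  obtain ⟨y₀, hy₀⟩ : ∃ y : g, y ≠ 0 := by
    by_contra! h
    exact LieAlgebra.IsSimple.non_abelian (R := ℂ) (L := g) ⟨fun x y => h _⟩
  have S : ∀ (u y : L) (n m : ℤ), ⁅V.d 0, u⁆ = (n : ℂ) • u → ⁅V.d 0, y⁆ = (m : ℂ) • y →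
      (m : ℂ) • ⁅y, F u (V.d 0)⁆ = (n : ℂ) • ⁅u, F (V.d 0) y⁆ := by
    intro u y n m hu hy
    have := AV_star F h1 h2 (V.d 0) y u (V.d 0)
    rw [hw, lie_self, zero_lie, zero_add, hy, ← lie_skew u (V.d 0), hu, neg_lie, smul_lie, smul_lie] at this
    linear_combination (norm := module) this
  have D : ∀ (u : L) (n : ℤ), ⁅V.d 0, u⁆ = (n : ℂ) • u →
      ⁅V.d 0, F u (V.d 0)⁆ = (n : ℂ) • F u (V.d 0) := by
    intro u n hu
    have := h1 (V.d 0) u (V.d 0)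
    rw [hw, hu, map_smul, LinearMap.smul_apply] at this
    simpa using this.symm
  have De : ∀ (u : L) (n : ℤ), ⁅V.d 0, u⁆ = (n : ℂ) • u → ∀ j, j ≠ n →
      e j (F u (V.d 0)) = 0 := by
    intro u n hu j hj
    have := congrArg (e j) (D u n hu)
    rw [C.ed (zero_add j), map_smul, ← sub_eq_zero, ← sub_smul, smul_eq_zero_iff_right] at this
    · exact this
    · rw [sub_ne_zero]; exact_mod_cast hj
  have Dc : ∀ (u : L) (n : ℤ), ⁅V.d 0, u⁆ = (n : ℂ) • u → ∀ j, j ≠ n →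
      c j (F u (V.d 0)) = 0 := by
    intro u n hu j hj
    have := congrArg (c j) (D u n hu)
    rw [C.cd (zero_add j), map_smul, ← sub_eq_zero, smul_eq_mul, ← sub_mul] at this
    rcases mul_eq_zero.1 this with h | h
    · exfalso; apply hj
      have : (j : ℂ) = n := by push_cast at h; linear_combination h
      exact_mod_cast this
    · exact h
  have cQ : ∀ m : ℤ, m ≠ 1 → c m (F (V.d 0) (V.d m)) = 0 := by
    intro m hm
    have := congrArg (c (m + 1)) (S (V.d 1) (V.d m) 1 m (b00 V 1) (b00 V m))
    rw [map_smul, map_smul, C.cd rfl, C.cd (add_comm 1 m), norm] at this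
    have hm' : (m : ℂ) - 1 ≠ 0 := by rw [sub_ne_zero]; exact_mod_cast hm
    simpa [hm'] using this.symm
  have pq : ∀ n m : ℤ, n ≠ 0 → m ≠ 0 → e n (F (V.d n) (V.d 0)) = e m (F (V.d 0) (V.d m)) := by
    intro n m hn hm
    have hn' : (n : ℂ) ≠ 0 := by exact_mod_cast hn
    have hm' : (m : ℂ) ≠ 0 := by exact_mod_cast hm
    have := congrArg (e (m + n)) (S (V.d n) (V.d m) n m (b00 V n) (b00 V m))
    rw [map_smul, map_smul, C.ed rfl, C.ed (add_comm n m), smul_smul, smul_smul,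
      mul_comm (n : ℂ)] at this
    exact smul_right_injective g (mul_ne_zero hm' hn') this
  have cn : ∀ n : ℤ, n ≠ 0 → c n (F (V.d n) (V.d 0)) = 0 := by
    intro n hn
    obtain ⟨m, hm0, hm1, hmn⟩ : ∃ m : ℤ, m ≠ 0 ∧ m ≠ 1 ∧ m ≠ n := by
      by_cases h : n = 2
      · exact ⟨3, by omega, by omega, by omega⟩
      · exact ⟨2, by omega, by omega, by omega⟩
    have := congrArg (c (m + n)) (S (V.d n) (V.d m) n m (b00 V n) (b00 V m))
    rw [map_smul, map_smul, C.cd rfl, C.cd (add_comm n m), cQ m hm1] at this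
    have hm' : (m : ℂ) ≠ 0 := by exact_mod_cast hm0
    have hmn' : (n : ℂ) - m ≠ 0 := by rw [sub_ne_zero]; exact_mod_cast hmn.symm
    simpa [hm', hmn'] using this
  have cEn : ∀ (n : ℤ) (x : g), c n (F (V.E n x) (V.d 0)) = 0 := by
    intro n x
    obtain ⟨m, hm0, hmn⟩ : ∃ m : ℤ, m ≠ 0 ∧ m ≠ n := by
      by_cases h : n = 2
      · exact ⟨3, by omega, by omega⟩
      · exact ⟨2, by omega, by omega⟩
    have := congrArg (c (m + n)) (S (V.E n x) (V.d m) n m (b0E V n x) (b00 V m))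
    rw [map_smul, map_smul, C.cd rfl, C.cE] at this
    have hm' : (m : ℂ) ≠ 0 := by exact_mod_cast hm0
    have hmn' : (n : ℂ) - m ≠ 0 := by rw [sub_ne_zero]; exact_mod_cast hmn.symm
    simpa [hm', hmn'] using this
  have R : ∀ (m n : ℤ) (x : g), m ≠ 0 → m ≠ 1 → n ≠ 0 → (m : ℂ) • e n (F (V.E n x) (V.d 0)) =
      ⁅x, e 1 (F (V.d 1) (V.d 0))⁆ := by
    intro m n x hm hm1 hn
    have hn' : (n : ℂ) ≠ 0 := by exact_mod_cast hn
    have := congrArg (e (m + n)) (S (V.E n x) (V.d m) n m (b0E V n x) (b00 V m))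
    rw [map_smul, map_smul, C.ed rfl, C.eE (add_comm n m), cQ m hm1, smul_comm,
      ← pq 1 m one_ne_zero hm] at this
    simpa using smul_right_injective g hn' this
  have R0 : ∀ (n : ℤ) (x : g), n ≠ 0 → e n (F (V.E n x) (V.d 0)) = 0 := by
    intro n x hn
    have a := R 2 n x (by omega) (by omega) hn
    have b := R 3 n x (by omega) (by omega) hn
    push_cast at a b
    linear_combination (norm := module) b - a
  have q0 : e 1 (F (V.d 1) (V.d 0)) = 0 := by
    apply simple_center
    intro x
    rw [← R 2 1 x (by omega) (by omega) (by omega), R0 1 x (by omega), smul_zero]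
  have cenK : ∀ k : L, (∀ v : L, ⁅v, k⁆ = 0) → ∀ v : L, ⁅v, F k (V.d 0)⁆ = 0 := by
    intro k hk v
    have := h1 v k (V.d 0)
    rw [hk, map_zero, LinearMap.zero_apply, ← lie_skew k, hk] at this
    simpa using this.symm
  have key : ((LieAlgebra.ad ℂ L v : L →ₗ[ℂ] L) ∘ₗ F.flip (V.d 0)) = 0 := by
    apply AV_ind V
    · simpa using cenK _ V.central_K₁ v
    · simpa using cenK _ V.central_K₂ v
    · intro n
      simp only [LinearMap.comp_apply, LinearMap.flip_apply, LieAlgebra.ad_apply, LinearMap.zero_apply]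
      by_cases hn : n = 0
      · rw [hn]; exact hw v
      · apply C.hz
        · intro j
          by_cases hj : j = n
          · rw [hj, pq n 1 hn one_ne_zero, ← pq 1 1 one_ne_zero one_ne_zero, q0]
          · exact De _ n (b00 V n) j hj
        · intro j
          by_cases hj : j = n
          · rw [hj, cn n hn]
          · exact Dc _ n (b00 V n) j hj
    · intro n x
      simp only [LinearMap.comp_apply, LinearMap.flip_apply, LieAlgebra.ad_apply, LinearMap.zero_apply]
      apply C.hz
      · intro j
        by_cases hj : j = n
        · rw [hj]
          by_cases hn : n = 0
          · subst hn
            apply simple_center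
            intro y
            have := congrArg (e 1) (S (V.E 0 x) (V.E 1 y) 0 1 (b0E V 0 x) (b0E V 1 y))
            rw [map_smul, map_smul, C.eE (add_zero 1), cEn] at this
            simpa using this
          · exact R0 n x hn
        · exact De _ n (b0E V n x) j hj
      · intro j
        by_cases hj : j = n
        · rw [hj, cEn]
        · exact Dc _ n (b0E V n x) j hj
  exact LinearMap.congr_fun key u

theorem AV_cen {g L : Type*} [LieRing g] [LieAlgebra ℂ g] [LieAlgebra.IsSimple ℂ g]
    [LieRing L] [LieAlgebra ℂ L] (V : AffineVirasoro g L)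
    {e : ℤ → L →ₗ[ℂ] g} {c : ℤ → L →ₗ[ℂ] ℂ} (C : AVC V e c) (a b : ℤ) (hab : a ≠ b) (z : L)
    (ha : ∀ x, ⁅V.E a x, z⁆ = 0) (hb : ∀ x, ⁅V.E b x, z⁆ = 0) (u : L) : ⁅u, z⁆ = 0 := by
  obtain ⟨y₀, hy₀⟩ : ∃ y : g, y ≠ 0 := by
    by_contra! h
    exact LieAlgebra.IsSimple.non_abelian (R := ℂ) (L := g) ⟨fun x y => h _⟩
  have A : ∀ j x, ⁅x, e j z⁆ - ((a : ℂ) * c j z) • x = 0 := by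
    intro j x; rw [← C.eE rfl, ha, map_zero]
  have B : ∀ j x, ⁅x, e j z⁆ - ((b : ℂ) * c j z) • x = 0 := by
    intro j x; rw [← C.eE rfl, hb, map_zero]
  have hc : ∀ j, c j z = 0 := by
    intro j
    have : (((a : ℂ) - b) * c j z) • y₀ = 0 := by
      linear_combination (norm := module) B j y₀ - A j y₀
    have hab' : (a : ℂ) - b ≠ 0 := by rw [sub_ne_zero]; exact_mod_cast hab
    simpa [hab', hy₀] using this
  refine C.hz z (fun j => simple_center _ fun x => ?_) hc u
  simpa [hc] using A j x

theorem AV_main {g L : Type*} [LieRing g] [LieAlgebra ℂ g] [LieAlgebra.IsSimple ℂ g]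
    [FiniteDimensional ℂ g]
    [LieRing L] [LieAlgebra ℂ L] (V : AffineVirasoro g L)
    {e : ℤ → L →ₗ[ℂ] g} {c : ℤ → L →ₗ[ℂ] ℂ} (C : AVC V e c)
    (F : L →ₗ[ℂ] L →ₗ[ℂ] L)
    (h1 : ∀ x y z : L, F ⁅x, y⁆ z = ⁅x, F y z⁆ - ⁅y, F x z⁆)
    (h2 : ∀ x y z : L, F x ⁅y, z⁆ = ⁅y, F x z⁆ - ⁅z, F x y⁆)
    (norm : c 1 (F (V.d 1) (V.d 0)) = 0) (x y : L) : F x y = 0 := by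
  have hP := AV_P V C F h1 h2 norm
  have homind : ∀ f : L →ₗ[ℂ] L, (∀ (z : L) (n : ℤ), ⁅V.d 0, z⁆ = (n : ℂ) • z → f z = 0) → f = 0 := by
    intro f hf
    apply AV_ind V
    · exact hf _ 0 (by simp [V.central_K₁])
    · exact hf _ 0 (by simp [V.central_K₂])
    · exact fun n => hf _ n (b00 V n)
    · exact fun n x => hf _ n (b0E V n x)
  have hQ : ∀ v y : L, ⁅v, F (V.d 0) y⁆ = 0 := by
    intro v y
    have key : ((LieAlgebra.ad ℂ L v : L →ₗ[ℂ] L) ∘ₗ F (V.d 0)) = 0 := by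
      apply homind
      intro z m hz
      have T : ∀ (a : ℤ), a ≠ 0 → ∀ x, ⁅V.E a x, F (V.d 0) z⁆ = 0 := by
        intro a ha x
        have := AV_star F h1 h2 (V.d 0) z (V.E a x) (V.d 0)
        rw [hP, hP, lie_self, zero_lie, ← lie_skew (V.E a x) (V.d 0), b0E, neg_lie, smul_lie] at this
        have ha' : (a : ℂ) ≠ 0 := by exact_mod_cast ha
        simpa [ha'] using this
      exact AV_cen V C 1 2 (by omega) _ (T 1 (by omega)) (T 2 (by omega)) v
    exact LinearMap.congr_fun key y
  have W : ∀ (z v : L) (n m : ℤ), ⁅V.d 0, z⁆ = (n : ℂ) • z → ⁅V.d 0, v⁆ = (m : ℂ) • v → n ≠ m →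
      F z v = 0 := by
    intro z v n m hz hv hnm
    have a := h1 (V.d 0) z v
    have b := h2 z (V.d 0) v
    rw [hz, hQ, map_smul, LinearMap.smul_apply] at a
    rw [hv, hP, map_smul] at b
    have : ((n : ℂ) - m) • F z v = 0 := by linear_combination (norm := module) a - b
    rcases smul_eq_zero.1 this with h | h
    · exfalso; apply hnm
      have : (n : ℂ) = m := by linear_combination h
      exact_mod_cast this
    · exact h
  have cen : ∀ (z v : L) (n m : ℤ), ⁅V.d 0, z⁆ = (n : ℂ) • z → ⁅V.d 0, v⁆ = (m : ℂ) • v →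
      ∀ u : L, ⁅u, F z v⁆ = 0 := by
    intro z v n m hz hv u
    by_cases hnm : n = m
    · subst hnm
      have T : ∀ (a : ℤ), a ≠ 0 → a ≠ n → ∀ x, ⁅V.E a x, F z v⁆ = 0 := by
        intro a ha han x
        have := h2 z (V.E a x) v
        rw [W z (V.E a x) n a hz (b0E V a x) (Ne.symm han), lie_zero, sub_zero] at this
        rw [← this]
        refine W _ _ n (a + n) hz ?_ (by omega)
        rw [leibniz_lie, b0E, hv, smul_lie, lie_smul]
        push_cast
        module
      obtain ⟨a, b, hab, ha, han, hb, hbn⟩ : ∃ a b : ℤ, a ≠ b ∧ a ≠ 0 ∧ a ≠ n ∧ b ≠ 0 ∧ b ≠ n := by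
        refine ⟨|n| + 1, |n| + 2, ?_, ?_, ?_, ?_, ?_⟩ <;> grind
      exact AV_cen V C a b hab _ (T a ha han) (T b hb hbn) u
    · rw [W z v n m hz hv hnm, lie_zero]
  have cen2 : ∀ (z : L) (n : ℤ), ⁅V.d 0, z⁆ = (n : ℂ) • z → ∀ u v : L, ⁅u, F z v⁆ = 0 := by
    intro z n hz u v
    have : ((LieAlgebra.ad ℂ L u : L →ₗ[ℂ] L) ∘ₗ F z) = 0 :=
      homind _ fun v m hv => cen z v n m hz hv u
    exact LinearMap.congr_fun this v
  have cen3 : ∀ u z v : L, ⁅u, F z v⁆ = 0 := by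
    intro u z v
    have : ((LieAlgebra.ad ℂ L u : L →ₗ[ℂ] L) ∘ₗ F.flip v) = 0 :=
      homind _ fun z m hz => cen2 z m hz u v
    exact LinearMap.congr_fun this z
  have := AV_perfect V (F.flip y) (by intro a b; simp [h1, cen3])
  exact LinearMap.congr_fun this x

/-- Every biderivation of the affine-Virasoro Lie algebra is inner. -/
theorem affineVirasoro_biderivation_inner (g L : Type*) [LieRing g] [LieAlgebra ℂ g] [LieAlgebra.IsSimple ℂ g] [FiniteDimensional ℂ g] [LieRing L] [LieAlgebra ℂ L] (V : AffineVirasoro g L)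
    (F : L →ₗ[ℂ] L →ₗ[ℂ] L)
    (h1 : ∀ x y z : L, F ⁅x, y⁆ z = ⁅x, F y z⁆ - ⁅y, F x z⁆)
    (h2 : ∀ x y z : L, F x ⁅y, z⁆ = ⁅y, F x z⁆ - ⁅z, F x y⁆) :
    ∃ lam : ℂ, ∀ x y : L, F x y = lam • ⁅x, y⁆ := by
  obtain ⟨e, c, hc1, hed, hcd, heE, hcE, hz⟩ := AV_coords' V
  have C : AVC V e c := by
    refine ⟨hc1, ?_, ?_, ?_, hcE, hz⟩
    · rintro m n j rfl; exact hed m n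
    · rintro m n j rfl; exact hcd m n
    · rintro m n j rfl; exact heE m n
  let lam : ℂ := -c 1 (F (V.d 1) (V.d 0))
  let G : L →ₗ[ℂ] L →ₗ[ℂ] L := F - lam • (LieModule.toEnd ℂ L L : L →ₗ[ℂ] L →ₗ[ℂ] L)
  have hG : ∀ x y, G x y = F x y - lam • ⁅x, y⁆ := fun x y => rfl
  refine ⟨lam, fun x y => ?_⟩
  rw [← sub_eq_zero, ← hG]
  apply AV_main V C G
  · intro x y z
    simp only [hG, h1, lie_sub, lie_smul, lie_lie]
    module
  · intro x y z
    simp only [hG, h2, lie_sub, lie_smul]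
    rw [leibniz_lie x y z, ← lie_skew z ⁅x, y⁆]
    module
  · rw [hG, ← lie_skew, b00, map_sub]
    simp [hc1, lam]
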